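/- For the additive two-way wiretap channel, I(Y_1 ; X_2 | X_1) − I(Y_1 ; Z | X_1) = H(N_1 − b_1·b_3^{−1}·N_3) − H(N_1), and this quantity is nonnegative, i.e., I(Y_1 ; Z | X_1) ≤ I(Y_1 ; X_2 | X_1). -/

import Mathlib

open Finset

noncomputable section

/-- Distribution (PMF) of a random variable `X` on a finite probability space `(Ω, μ)`. -/
def dist' {Ω A : Type*} [Fintype Ω] [DecidableEq A] (μ : Ω → ℝ) (X : Ω → A) (a : A) : ℝ :=
  ∑ ω, if X ω = a then μ ω else 0

/-- Shannon entropy (natural logarithm) of a random variable `X` on `(Ω, μ)`. -/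
def entropy' {Ω A : Type*} [Fintype Ω] [Fintype A] [DecidableEq A]
    (μ : Ω → ℝ) (X : Ω → A) : ℝ :=
  -∑ a, dist' μ X a * Real.log (dist' μ X a)

/-- Shannon mutual information `I(X;Y)` (natural logarithm). -/
def mi {Ω A B : Type*} [Fintype Ω] [Fintype A] [Fintype B] [DecidableEq A] [DecidableEq B]
    (μ : Ω → ℝ) (X : Ω → A) (Y : Ω → B) : ℝ :=
  entropy' μ X + entropy' μ Y - entropy' μ (fun ω => (X ω, Y ω))

/-- Shannon conditional mutual information `I(X;Y|C)` (natural logarithm),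
via `I(X;Y|C) = H(X,C) + H(Y,C) − H(X,Y,C) − H(C)`. -/
def cmi {Ω A B C : Type*} [Fintype Ω] [Fintype A] [Fintype B] [Fintype C]
    [DecidableEq A] [DecidableEq B] [DecidableEq C]
    (μ : Ω → ℝ) (X : Ω → A) (Y : Ω → B) (C' : Ω → C) : ℝ :=
  entropy' μ (fun ω => (X ω, C' ω)) + entropy' μ (fun ω => (Y ω, C' ω)) -
    entropy' μ (fun ω => (X ω, Y ω, C' ω)) - entropy' μ C'

section Entropy

variable {Ω A B S T : Type*} [Fintype Ω]

theorem entropy'_eq_sum_negMulLog [Fintype A] [DecidableEq A] (μ : Ω → ℝ) (X : Ω → A) :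
    entropy' μ X = ∑ a, Real.negMulLog (dist' μ X a) := by
  simp [entropy', Real.negMulLog]

theorem dist'_nonneg [DecidableEq A] {μ : Ω → ℝ} (hμ : ∀ ω, 0 ≤ μ ω) (X : Ω → A) (a : A) :
    0 ≤ dist' μ X a :=
  Finset.sum_nonneg fun ω _ => by split_ifs <;> simp [hμ]

theorem sum_dist' [Fintype A] [DecidableEq A] (μ : Ω → ℝ) (X : Ω → A) :
    ∑ a, dist' μ X a = ∑ ω, μ ω := by
  simp only [dist']
  rw [Finset.sum_comm]
  simp

theorem dist'_comp [Fintype A] [DecidableEq A] [DecidableEq B] (μ : Ω → ℝ) (X : Ω → A)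
    (f : A → B) (b : B) :
    dist' μ (fun ω => f (X ω)) b = ∑ a, if f a = b then dist' μ X a else 0 := by
  simp only [dist', ← Finset.sum_filter (fun a => f a = b)]
  rw [Finset.sum_comm]
  simp

theorem dist'_comp_injective [DecidableEq A] [DecidableEq B] (μ : Ω → ℝ) (X : Ω → A)
    {f : A → B} (hf : Function.Injective f) (a : A) :
    dist' μ (fun ω => f (X ω)) (f a) = dist' μ X a := by
  simp only [dist', hf.eq_iff]

theorem entropy'_comp_injective [Fintype A] [Fintype B] [DecidableEq A] [DecidableEq B]
    (μ : Ω → ℝ) (X : Ω → A) {f : A → B} (hf : Function.Injective f) :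
    entropy' μ (fun ω => f (X ω)) = entropy' μ X := by
  rw [entropy'_eq_sum_negMulLog, entropy'_eq_sum_negMulLog]
  refine (Fintype.sum_of_injective f hf _ _ (fun b hb => ?_) fun a => ?_).symm
  · have : dist' μ (fun ω => f (X ω)) b = 0 :=
      Finset.sum_eq_zero fun ω _ => if_neg fun h => hb ⟨X ω, h⟩
    rw [this, Real.negMulLog_zero]
  · rw [dist'_comp_injective μ X hf]

/-- If `X` is uniform and independent of `T`, then so is any `T`-dependent permutation of `X`. -/
theorem dist'_perm_of_uniform_indep [Fintype A] [DecidableEq A] [Fintype T] [DecidableEq T]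
    [DecidableEq S] (μ : Ω → ℝ) (X : Ω → A) (Y : Ω → T) (c : ℝ)
    (h : ∀ a t, dist' μ (fun ω => (X ω, Y ω)) (a, t) = c * dist' μ Y t)
    (φ : T → A → A) (hφ : ∀ t, Function.Injective (φ t)) (g : T → S) (a : A) (s : S) :
    dist' μ (fun ω => (φ (Y ω) (X ω), g (Y ω))) (a, s) =
      c * dist' μ (fun ω => g (Y ω)) s := by
  rw [dist'_comp μ (fun ω => (X ω, Y ω)) (fun p => (φ p.2 p.1, g p.2)), dist'_comp μ Y g,
    Fintype.sum_prod_type_right, Finset.mul_sum]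
  refine Finset.sum_congr rfl fun t _ => ?_
  obtain ⟨a', rfl⟩ := (Finite.injective_iff_surjective.mp (hφ t)) a
  simp only [Prod.mk.injEq, (hφ t).eq_iff, h, ite_and]
  simp

theorem entropy'_perm_of_uniform_indep [Fintype A] [Nonempty A] [DecidableEq A] [Fintype T]
    [DecidableEq T] [Fintype S] [DecidableEq S] (μ : Ω → ℝ) (hμ : ∑ ω, μ ω = 1)
    (X : Ω → A) (Y : Ω → T)
    (h : ∀ a t, dist' μ (fun ω => (X ω, Y ω)) (a, t) = (Fintype.card A : ℝ)⁻¹ * dist' μ Y t)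
    (φ : T → A → A) (hφ : ∀ t, Function.Injective (φ t)) (g : T → S) :
    entropy' μ (fun ω => (φ (Y ω) (X ω), g (Y ω))) =
      Real.log (Fintype.card A) + entropy' μ (fun ω => g (Y ω)) := by
  have hA : (Fintype.card A : ℝ) ≠ 0 := by simp
  rw [entropy'_eq_sum_negMulLog, entropy'_eq_sum_negMulLog, Fintype.sum_prod_type]
  simp only [dist'_perm_of_uniform_indep μ X Y _ h φ hφ g, Real.negMulLog_mul,
    Finset.sum_add_distrib, ← Finset.sum_mul, ← Finset.mul_sum, sum_dist', hμ]
  simp only [Real.negMulLog, Real.log_inv, Finset.sum_const, Finset.card_univ, nsmul_eq_mul]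
  field_simp

theorem entropy'_perm_eq_log_card [Fintype A] [Nonempty A] [DecidableEq A] [Fintype T]
    [DecidableEq T] (μ : Ω → ℝ) (hμ : ∑ ω, μ ω = 1) (X : Ω → A) (Y : Ω → T)
    (h : ∀ a t, dist' μ (fun ω => (X ω, Y ω)) (a, t) = (Fintype.card A : ℝ)⁻¹ * dist' μ Y t)
    (φ : T → A → A) (hφ : ∀ t, Function.Injective (φ t)) :
    entropy' μ (fun ω => φ (Y ω) (X ω)) = Real.log (Fintype.card A) := by
  have hinj : Function.Injective fun a : A => (a, ()) := fun a b hab => congrArg Prod.fst hab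
  rw [← entropy'_comp_injective μ (fun ω => φ (Y ω) (X ω)) hinj,
    entropy'_perm_of_uniform_indep μ hμ X Y h φ hφ fun _ => ()]
  simp [entropy', dist', hμ]

/-- Subtracting an independent variable does not decrease entropy. -/
theorem entropy'_le_entropy'_sub_of_indep [Fintype A] [AddCommGroup A] [DecidableEq A]
    [Fintype B] [DecidableEq B] (μ : Ω → ℝ) (hμ0 : ∀ ω, 0 ≤ μ ω) (hμ : ∑ ω, μ ω = 1)
    (X : Ω → A) (Y : Ω → B)
    (h : ∀ a b, dist' μ (fun ω => (X ω, Y ω)) (a, b) = dist' μ X a * dist' μ Y b) (g : B → A) :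
    entropy' μ X ≤ entropy' μ (fun ω => X ω - g (Y ω)) := by
  have hdist (u : A) : dist' μ (fun ω => X ω - g (Y ω)) u =
      ∑ b, dist' μ Y b • dist' μ X (u + g b) := by
    rw [dist'_comp μ (fun ω => (X ω, Y ω)) (fun p => p.1 - g p.2), Fintype.sum_prod_type_right]
    simp [h, sub_eq_iff_eq_add, mul_comm]
  have hconc (u : A) : ∑ b, dist' μ Y b • Real.negMulLog (dist' μ X (u + g b)) ≤
      Real.negMulLog (dist' μ (fun ω => X ω - g (Y ω)) u) := by
    rw [hdist]
    exact Real.concaveOn_negMulLog.le_map_sum (fun b _ => dist'_nonneg hμ0 Y b)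
      (by rw [sum_dist', hμ]) fun b _ => dist'_nonneg hμ0 X _
  rw [entropy'_eq_sum_negMulLog, entropy'_eq_sum_negMulLog]
  refine le_trans (le_of_eq ?_) (Finset.sum_le_sum fun u _ => hconc u)
  rw [Finset.sum_comm]
  have hshift (b : B) : ∑ u, Real.negMulLog (dist' μ X (u + g b)) =
      ∑ u, Real.negMulLog (dist' μ X u) :=
    Equiv.sum_comp (Equiv.addRight (g b)) fun u => Real.negMulLog (dist' μ X u)
  simp only [smul_eq_mul, ← Finset.mul_sum, hshift, ← Finset.sum_mul, sum_dist', hμ, one_mul]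

end Entropy

/-- For the additive two-way wiretap channel, `I(Y1;X2|X1) − I(Y1;Z|X1) = H(N1 − b1 b3⁻¹ N3) − H(N1)`, and this quantity is nonnegative. -/
theorem additive_secrecy_gap {Ω F : Type*} [Fintype Ω] [Field F] [Fintype F] [DecidableEq F]
    (μ : Ω → ℝ) (hμ0 : ∀ ω, 0 ≤ μ ω) (hμ1 : ∑ ω, μ ω = 1)
    (a1 b1 a2 b2 a3 b3 : F)
    (ha1 : a1 ≠ 0) (hb1 : b1 ≠ 0) (ha2 : a2 ≠ 0)
    (hb2 : b2 ≠ 0) (ha3 : a3 ≠ 0) (hb3 : b3 ≠ 0)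
    (X1 X2 N1 N2 N3 : Ω → F)
    (hX1unif : ∀ x, dist' μ X1 x = 1 / (Fintype.card F : ℝ))
    (hX2unif : ∀ x, dist' μ X2 x = 1 / (Fintype.card F : ℝ))
    (hindep : ∀ x1 x2 n1 n2 n3,
      dist' μ (fun ω => (X1 ω, X2 ω, N1 ω, N2 ω, N3 ω)) (x1, x2, n1, n2, n3) =
        dist' μ X1 x1 * dist' μ X2 x2 * dist' μ N1 n1 * dist' μ N2 n2 * dist' μ N3 n3) :
    cmi μ (fun ω => a1 * X1 ω + b1 * X2 ω + N1 ω) X2 X1 -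
      cmi μ (fun ω => a1 * X1 ω + b1 * X2 ω + N1 ω)
        (fun ω => a3 * X1 ω + b3 * X2 ω + N3 ω) X1 =
      entropy' μ (fun ω => N1 ω - b1 * b3⁻¹ * N3 ω) - entropy' μ N1 ∧
    cmi μ (fun ω => a1 * X1 ω + b1 * X2 ω + N1 ω)
        (fun ω => a3 * X1 ω + b3 * X2 ω + N3 ω) X1 ≤
      cmi μ (fun ω => a1 * X1 ω + b1 * X2 ω + N1 ω) X2 X1 := by
  have hjoint (x1 x2 n1 n3 : F) :
      dist' μ (fun ω => ((X1 ω, X2 ω), (N1 ω, N3 ω))) ((x1, x2), (n1, n3)) =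
        dist' μ X1 x1 * dist' μ X2 x2 * (dist' μ N1 n1 * dist' μ N3 n3) := by
    have hmarg : dist' μ (fun ω => ((X1 ω, X2 ω), (N1 ω, N3 ω))) ((x1, x2), (n1, n3)) =
        ∑ n2, dist' μ (fun ω => (X1 ω, X2 ω, N1 ω, N2 ω, N3 ω)) (x1, x2, n1, n2, n3) := by
      simp only [dist']
      rw [Finset.sum_comm]
      refine Finset.sum_congr rfl fun ω _ => ?_
      simp only [Prod.mk.injEq, ite_and, Finset.sum_ite_irrel, Finset.sum_const_zero,
        Finset.sum_ite_eq, Finset.mem_univ, if_true]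
    rw [hmarg]
    simp only [hindep, ← Finset.sum_mul, ← Finset.mul_sum, sum_dist', hμ1]
    ring
  have hnoise (n1 n3 : F) :
      dist' μ (fun ω => (N1 ω, N3 ω)) (n1, n3) = dist' μ N1 n1 * dist' μ N3 n3 := by
    have hmarg : dist' μ (fun ω => (N1 ω, N3 ω)) (n1, n3) =
        ∑ x : F × F, dist' μ (fun ω => ((X1 ω, X2 ω), (N1 ω, N3 ω))) (x, (n1, n3)) := by
      simp only [dist']
      rw [Finset.sum_comm]
      refine Finset.sum_congr rfl fun ω _ => ?_
      simp only [Prod.mk.injEq (X1 ω, X2 ω), ite_and, Finset.sum_ite_eq, Finset.mem_univ, if_true]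
    rw [hmarg, Fintype.sum_prod_type]
    simp only [hjoint, ← Finset.sum_mul, ← Finset.mul_sum, sum_dist', hμ1, one_mul]
  have hunif (x n : F × F) : dist' μ (fun ω => ((X1 ω, X2 ω), (N1 ω, N3 ω))) (x, n) =
      (Fintype.card (F × F) : ℝ)⁻¹ * dist' μ (fun ω => (N1 ω, N3 ω)) n := by
    obtain ⟨x1, x2⟩ := x
    obtain ⟨n1, n3⟩ := n
    rw [hjoint, hnoise, hX1unif, hX2unif, Fintype.card_prod]
    push_cast
    rw [mul_inv, one_div]
  have hswap : Function.Injective (Prod.swap : F × F → F × F) := Prod.swap_injective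
  have hobs (n : F × F) :
      Function.Injective fun x : F × F => (a3 * x.1 + b3 * x.2 + n.2, x.1) := by
    rintro ⟨x1, x2⟩ ⟨y1, y2⟩ hxy
    simp only [Prod.mk.injEq] at hxy ⊢
    obtain ⟨hz, rfl⟩ := hxy
    simpa [hb3] using hz
  have hX21 : entropy' μ (fun ω => (X2 ω, X1 ω)) = Real.log (Fintype.card (F × F)) :=
    entropy'_perm_eq_log_card μ hμ1 (fun ω => (X1 ω, X2 ω)) (fun ω => (N1 ω, N3 ω)) hunif
      (fun _ => Prod.swap) fun _ => hswap
  have hZX1 : entropy' μ (fun ω => (a3 * X1 ω + b3 * X2 ω + N3 ω, X1 ω)) =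
      Real.log (Fintype.card (F × F)) :=
    entropy'_perm_eq_log_card μ hμ1 (fun ω => (X1 ω, X2 ω)) (fun ω => (N1 ω, N3 ω)) hunif
      (fun n x => (a3 * x.1 + b3 * x.2 + n.2, x.1)) hobs
  have hYX21 : entropy' μ (fun ω => (a1 * X1 ω + b1 * X2 ω + N1 ω, X2 ω, X1 ω)) =
      Real.log (Fintype.card (F × F)) + entropy' μ N1 := by
    have hinj : Function.Injective fun p : (F × F) × F =>
        (a1 * p.1.2 + b1 * p.1.1 + p.2, p.1.1, p.1.2) := by
      rintro ⟨⟨x2, x1⟩, n⟩ ⟨⟨y2, y1⟩, m⟩ h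
      simp only [Prod.mk.injEq] at h ⊢
      obtain ⟨h, rfl, rfl⟩ := h
      simpa using h
    exact (entropy'_comp_injective μ (fun ω => ((X2 ω, X1 ω), N1 ω)) hinj).trans
      (entropy'_perm_of_uniform_indep μ hμ1 (fun ω => (X1 ω, X2 ω)) (fun ω => (N1 ω, N3 ω)) hunif
        (fun _ => Prod.swap) (fun _ => hswap) Prod.fst)
  have hYZX1 : entropy' μ (fun ω => (a1 * X1 ω + b1 * X2 ω + N1 ω,
      a3 * X1 ω + b3 * X2 ω + N3 ω, X1 ω)) =
      Real.log (Fintype.card (F × F)) + entropy' μ (fun ω => N1 ω - b1 * b3⁻¹ * N3 ω) := by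
    have hinj : Function.Injective fun p : (F × F) × F =>
        (a1 * p.1.2 + b1 * b3⁻¹ * (p.1.1 - a3 * p.1.2) + p.2, p.1.1, p.1.2) := by
      rintro ⟨⟨z, x⟩, n⟩ ⟨⟨w, y⟩, m⟩ h
      simp only [Prod.mk.injEq] at h ⊢
      obtain ⟨h, rfl, rfl⟩ := h
      simpa using h
    have hY : (fun ω => (a1 * X1 ω + b1 * X2 ω + N1 ω, a3 * X1 ω + b3 * X2 ω + N3 ω, X1 ω)) =
        fun ω => (a1 * X1 ω + b1 * b3⁻¹ * ((a3 * X1 ω + b3 * X2 ω + N3 ω) - a3 * X1 ω) +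
          (N1 ω - b1 * b3⁻¹ * N3 ω), a3 * X1 ω + b3 * X2 ω + N3 ω, X1 ω) := by
      funext ω
      refine Prod.ext ?_ rfl
      field_simp
      ring
    rw [hY]
    exact (entropy'_comp_injective μ (fun ω => ((a3 * X1 ω + b3 * X2 ω + N3 ω, X1 ω),
        N1 ω - b1 * b3⁻¹ * N3 ω)) hinj).trans
      (entropy'_perm_of_uniform_indep μ hμ1 (fun ω => (X1 ω, X2 ω)) (fun ω => (N1 ω, N3 ω)) hunif
        (fun n x => (a3 * x.1 + b3 * x.2 + n.2, x.1)) hobs fun n => n.1 - b1 * b3⁻¹ * n.2)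
  have hgap := entropy'_le_entropy'_sub_of_indep μ hμ0 hμ1 N1 N3 hnoise fun n => b1 * b3⁻¹ * n
  simp only [cmi, hX21, hZX1, hYX21, hYZX1]
  constructor <;> linarith

end
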